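/- arXiv:2306.08950 — 2 statements merged into one kernel-verified Lean document; each statement's English description precedes it below -/
import Mathlib

section
/- Let q be a prime power, m ≥ 0, n = n_0 + ⋯ + n_l with each n_j ≥ 0, β_j = n_j + n_{j+1} + ⋯ + n_l, and γ_0,…,γ_l : 𝔽_q^× → ℂ^× group homomorphisms. Let Λ_m(g) = #{(A_1,…,A_m) ∈ Mat_n(𝔽_q)^m : gA_r = A_r g for all r}. For g ∈ GL_n(𝔽_q) and (g_1,…,g_l) ∈ ∏_{j=1}^l GL_{β_j}(𝔽_q), set g_0 = g and define N(g, g_1,…,g_l) = #{(A_1,…,A_m, f_1,…,f_l) : A_r ∈ Mat_n(𝔽_q) with gA_r = A_r g; f_j : 𝔽_q^{β_j} → 𝔽_q^{β_{j−1}} injective linear with g_{j−1} f_j = f_j g_j}, and ρ(g, g_1,…,g_l) = γ_0(det g) · ∏_{j=1}^l (γ_j γ_{j−1}^{−1})(det g_j). Then for every g ∈ GL_n(𝔽_q): Λ_m(g) · R(γ_0,…,γ_l)(g) = (1/∏_{j=1}^l |GL_{β_j}(𝔽_q)|) · Σ_{(g_1,…,g_l) ∈ ∏_j GL_{β_j}(𝔽_q)}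 N(g, g_1,…,g_l) · ρ(g, g_1,…,g_l). -/
open Matrix

namespace QRep

open scoped Classical

/-- Apply a character `χ : 𝔽_q^× → ℂ^×` to a field element (0 outside the units). -/
noncomputable def χap {F : Type} [Field F] (χ : Fˣ →* ℂˣ) (d : F) : ℂ :=
  if h : d = 0 then 0 else χ (Units.mk0 d h)

/-- The determinant of the endomorphism induced by `T` on the subquotient `W / (U ∩ W)`
(defined to be `0` if `T` does not preserve `W` and `U`). -/
noncomputable def quotDet {F M : Type} [Field F] [AddCommGroup M] [Module F M]
    (T : M →ₗ[F] M) (W U : Submodule F M) : F :=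
  if h : (∀ x ∈ W, T x ∈ W) ∧ (∀ x ∈ U, T x ∈ U) then
    LinearMap.det (Submodule.mapQ (U.comap W.subtype) (U.comap W.subtype) (T.restrict h.1)
      (fun x hx => by
        simpa only [Submodule.mem_comap, LinearMap.restrict_apply, Submodule.subtype_apply]
          using h.2 x.1 hx))
  else 0

/-- The Harish-Chandra induced character of the linear character `γ` of the Levi
`GL_{n_0} × ⋯ × GL_{n_l}` of `GL_n(𝔽_q)`, evaluated at `g`: the sum over all `g`-stable
flags `𝔽_q^n = V_0 ⊇ V_1 ⊇ ⋯` with `dim V_j = β j`, of `∏_{j=0}^{l} γ_j(det(ḡ_j))`,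
where `ḡ_j` is the automorphism induced by `g` on `V_j / V_{j+1}`. -/
noncomputable def HC (F : Type) [Field F] (n l : ℕ) (β : ℕ → ℕ) (γ : ℕ → (Fˣ →* ℂˣ))
    (g : GL (Fin n) F) : ℂ :=
  ∑ᶠ V : {V : ℕ → Submodule F (Fin n → F) //
      V 0 = ⊤ ∧ (∀ j, V (j + 1) ≤ V j) ∧ (∀ j, Module.finrank F (V j) = β j) ∧
      (∀ j, ∀ v ∈ V j, Matrix.mulVecLin (g : Matrix (Fin n) (Fin n) F) v ∈ V j)},
    ∏ j ∈ Finset.range (l + 1),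
      χap (γ j) (quotDet (Matrix.mulVecLin (g : Matrix (Fin n) (Fin n) F))
        (V.1 j) (V.1 (j + 1)))

/-- The number of `m`-tuples of `n × n` matrices commuting with `g`; i.e. the character
of the conjugation action of `GL_n(𝔽_q)` on `𝔤𝔩_n(𝔽_q)^m`. -/
noncomputable def Λcount (F : Type) [Field F] (n m : ℕ) (g : GL (Fin n) F) : ℕ :=
  Nat.card {A : Fin m → Matrix (Fin n) (Fin n) F //
    ∀ r, (g : Matrix (Fin n) (Fin n) F) * A r = A r * (g : Matrix (Fin n) (Fin n) F)}


/-- Extend the tuple `(g, g_1, …, g_l)` to a family indexed by `ℕ` (by `1` beyond `l`). -/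
def extG (F : Type) [Field F] (l : ℕ) (β : ℕ → ℕ) (g : GL (Fin (β 0)) F)
    (gs : (j : Fin l) → GL (Fin (β (j.1 + 1))) F) : (j : ℕ) → GL (Fin (β j)) F
  | 0 => g
  | (j + 1) => if h : j < l then gs ⟨j, h⟩ else 1

/-- The count `N(g, g_1, …, g_l)`: tuples `(A_1,…,A_m, f_1,…,f_l)` where the `A_r` are
`n × n` matrices commuting with `g = G 0`, and `f_j` is an injective linear map
`𝔽_q^{β_j} → 𝔽_q^{β_{j-1}}` with `g_{j-1} f_j = f_j g_j`. -/
noncomputable def Ncount (F : Type) [Field F] (m l : ℕ) (β : ℕ → ℕ)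
    (G : (j : ℕ) → GL (Fin (β j)) F) : ℕ :=
  Nat.card {Af : (Fin m → Matrix (Fin (β 0)) (Fin (β 0)) F) ×
      ((j : Fin l) → Matrix (Fin (β j.1)) (Fin (β (j.1 + 1))) F) //
    (∀ r, ((G 0 : GL (Fin (β 0)) F) : Matrix (Fin (β 0)) (Fin (β 0)) F) * Af.1 r
        = Af.1 r * ((G 0 : GL (Fin (β 0)) F) : Matrix (Fin (β 0)) (Fin (β 0)) F)) ∧
    (∀ j, Function.Injective (Matrix.mulVecLin (Af.2 j))) ∧
    (∀ j : Fin l, ((G j.1 : GL (Fin (β j.1)) F) : Matrix (Fin (β j.1)) (Fin (β j.1)) F) * Af.2 j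
        = Af.2 j * ((G (j.1 + 1) : GL (Fin (β (j.1 + 1))) F) :
            Matrix (Fin (β (j.1 + 1))) (Fin (β (j.1 + 1))) F))}


end QRep

namespace QRep

section Matrices

variable {F : Type} [Field F] {n k k' : Type} [Fintype k]

theorem exists_mul_eq_of_range_le [Fintype k'] (A : Matrix n k F) (B : Matrix n k' F)
    (h : LinearMap.range B.mulVecLin ≤ LinearMap.range A.mulVecLin) :
    ∃ C : Matrix k k' F, A * C = B := by
  classical
  have hc : ∀ j, ∃ c, A *ᵥ c = B.col j := fun j => by
    obtain ⟨c, hc⟩ := h ⟨Pi.single j 1, rfl⟩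
    exact ⟨c, by simpa using hc⟩
  choose c hc using hc
  refine ⟨Matrix.of fun i j => c j i, ?_⟩
  ext i j
  exact congrFun (hc j) i

theorem mul_left_cancel_of_injective {A : Matrix n k F}
    (hA : Function.Injective A.mulVecLin) {C D : Matrix k k' F} (h : A * C = A * D) :
    C = D := by
  ext i j
  have : A.mulVecLin (C.col j) = A.mulVecLin (D.col j) := by
    ext i
    exact congrFun (congrFun h i) j
  exact congrFun (hA this) i

theorem injective_of_mul_injective [Fintype k'] {A : Matrix n k F} {C : Matrix k k' F}
    (h : Function.Injective (A * C).mulVecLin) : Function.Injective C.mulVecLin := by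
  rw [Matrix.mulVecLin_mul, LinearMap.coe_comp] at h
  exact h.of_comp

theorem mul_injective [Fintype k'] {A : Matrix n k F} {C : Matrix k k' F}
    (hA : Function.Injective A.mulVecLin) (hC : Function.Injective C.mulVecLin) :
    Function.Injective (A * C).mulVecLin := by
  rw [Matrix.mulVecLin_mul, LinearMap.coe_comp]
  exact hA.comp hC

theorem range_mul_le [Fintype k'] (A : Matrix n k F) (C : Matrix k k' F) :
    LinearMap.range (A * C).mulVecLin ≤ LinearMap.range A.mulVecLin := by
  rw [Matrix.mulVecLin_mul]
  exact LinearMap.range_comp_le_range _ _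

theorem injective_of_gl [DecidableEq k] (a : GL k F) :
    Function.Injective (a : Matrix k k F).mulVecLin := by
  exact Matrix.mulVec_injective_of_isUnit a.isUnit

theorem exists_gl_of_injective [DecidableEq k] {C : Matrix k k F}
    (h : Function.Injective C.mulVecLin) : ∃ a : GL k F, (a : Matrix k k F) = C :=
  Matrix.mulVec_injective_iff_isUnit.1 h

theorem range_mul_gl [DecidableEq k] (A : Matrix n k F) (a : GL k F) :
    LinearMap.range (A * (a : Matrix k k F)).mulVecLin = LinearMap.range A.mulVecLin := by
  refine le_antisymm (range_mul_le _ _) ?_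
  have h := range_mul_le (A * (a : Matrix k k F)) ((a⁻¹ : GL k F) : Matrix k k F)
  rwa [Matrix.mul_assoc, Units.mul_inv, Matrix.mul_one] at h

/-- A matrix with independent columns spanning an invariant subspace intertwines the given
invertible matrix with an invertible one. -/
theorem exists_gl_intertwining [Fintype n] [DecidableEq n] [DecidableEq k] (g : GL n F)
    {E : Matrix n k F}
    (hE : Function.Injective E.mulVecLin)
    (h : ∀ v ∈ LinearMap.range E.mulVecLin,
      (g : Matrix n n F).mulVecLin v ∈ LinearMap.range E.mulVecLin) :
    ∃ a : GL k F, (g : Matrix n n F) * E = E * (a : Matrix k k F) := by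
  obtain ⟨C, hC⟩ := exists_mul_eq_of_range_le E ((g : Matrix n n F) * E) (by
    rintro _ ⟨v, rfl⟩
    rw [Matrix.mulVecLin_mul]
    exact h _ ⟨v, rfl⟩)
  obtain ⟨a, rfl⟩ := exists_gl_of_injective (C := C)
    (injective_of_mul_injective (A := E) (hC ▸ mul_injective (injective_of_gl g) hE))
  exact ⟨a, hC.symm⟩

theorem exists_matrix_range_eq [Finite n] (b : ℕ) (V : Submodule F (n → F))
    (hV : Module.finrank F V = b) :
    ∃ E : Matrix n (Fin b) F, Function.Injective E.mulVecLin ∧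
      LinearMap.range E.mulVecLin = V := by
  classical
  have e : (Fin b → F) ≃ₗ[F] V := LinearEquiv.ofFinrankEq _ _ (by simp [hV])
  refine ⟨LinearMap.toMatrix' (V.subtype ∘ₗ e.toLinearMap), ?_, ?_⟩ <;>
    rw [← Matrix.toLin'_apply', Matrix.toLin'_toMatrix']
  · exact V.injective_subtype.comp e.injective
  · rw [LinearMap.range_comp, LinearEquiv.range, Submodule.map_top, Submodule.range_subtype]

end Matrices

section Determinants

variable {F : Type} [Field F]

theorem det_eq_of_intertwining {M N : Type} [AddCommGroup M] [Module F M] [AddCommGroup N]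
    [Module F N] (e : M ≃ₗ[F] N) (S : M →ₗ[F] M) (T : N →ₗ[F] N)
    (h : ∀ x, T (e x) = e (S x)) : LinearMap.det T = LinearMap.det S := by
  rw [← LinearMap.det_conj S e]
  congr 1
  ext y
  simpa using h (e.symm y)

theorem quotDet_mul_det {M : Type} [AddCommGroup M] [Module F M] [FiniteDimensional F M]
    {a b : Type} [Fintype a] [DecidableEq a] [Fintype b] [DecidableEq b]
    (T : M →ₗ[F] M) (A : (a → F) →ₗ[F] M) (B : (b → F) →ₗ[F] M)
    (hA : Function.Injective A) (hB : Function.Injective B)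
    (hle : LinearMap.range B ≤ LinearMap.range A) (G : Matrix a a F) (H : Matrix b b F)
    (hG : ∀ x, T (A x) = A (G *ᵥ x)) (hH : ∀ x, T (B x) = B (H *ᵥ x)) :
    quotDet T (LinearMap.range A) (LinearMap.range B) * H.det = G.det := by
  have hW : ∀ x ∈ LinearMap.range A, T x ∈ LinearMap.range A := by
    rintro _ ⟨x, rfl⟩
    exact ⟨_, (hG x).symm⟩
  have hU : ∀ x ∈ LinearMap.range B, T x ∈ LinearMap.range B := by
    rintro _ ⟨x, rfl⟩
    exact ⟨_, (hH x).symm⟩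
  have hU' : (LinearMap.range B).comap (LinearMap.range A).subtype ≤
      ((LinearMap.range B).comap (LinearMap.range A).subtype).comap (T.restrict hW) :=
    fun x hx => hU x.1 hx
  have hdetG : LinearMap.det (T.restrict hW) = G.det := by
    rw [det_eq_of_intertwining (LinearEquiv.ofInjective A hA) (Matrix.toLin' G),
      LinearMap.det_toLin']
    intro x
    ext
    simpa using hG x
  have hdetH : LinearMap.det ((T.restrict hW).restrict hU') = H.det := by
    rw [det_eq_of_intertwining ((LinearEquiv.ofInjective B hB).trans
      (Submodule.comapSubtypeEquivOfLe hle).symm) (Matrix.toLin' H), LinearMap.det_toLin']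
    intro x
    ext
    simpa using hH x
  rw [quotDet, dif_pos ⟨hW, hU⟩, ← hdetG, ← hdetH, mul_comm]
  exact (LinearMap.det_eq_det_mul_det _ _ hU').symm

theorem χap_of_mul_eq (χ : Fˣ →* ℂˣ) {x : F} {c d : Fˣ} (h : x * d = c) :
    χap χ x = (χ c : ℂ) * ((χ d)⁻¹ : ℂˣ) := by
  have hx : x = ((c * d⁻¹ : Fˣ) : F) := by
    rw [Units.val_mul, ← h, mul_assoc, Units.mul_inv, mul_one]
  rw [χap, dif_neg (hx ▸ Units.ne_zero _), ← Units.val_mul, ← map_inv, ← map_mul]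
  congr 2
  exact Units.ext hx

end Determinants

section Chains

variable {F : Type} [Field F] {β : ℕ → ℕ}

/-- The composite of the first `j` maps of a chain. -/
def chainComp (f : (j : ℕ) → Matrix (Fin (β j)) (Fin (β (j + 1))) F) :
    (j : ℕ) → Matrix (Fin (β 0)) (Fin (β j)) F
  | 0 => 1
  | j + 1 => chainComp f j * f j

/-- Extend a chain of matrices by zero beyond `l`. -/
def extF (l : ℕ) (f : (j : Fin l) → Matrix (Fin (β j.1)) (Fin (β (j.1 + 1))) F) (j : ℕ) :
    Matrix (Fin (β j)) (Fin (β (j + 1))) F :=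
  if h : j < l then f ⟨j, h⟩ else 0

theorem extF_of_fin (l : ℕ) (f : (j : Fin l) → Matrix (Fin (β j.1)) (Fin (β (j.1 + 1))) F)
    (j : Fin l) : extF l f j = f j := dif_pos j.2

theorem extG_of_fin (l : ℕ) (g : GL (Fin (β 0)) F)
    (gs : (j : Fin l) → GL (Fin (β (j.1 + 1))) F) (j : Fin l) :
    extG F l β g gs (j + 1) = gs j := dif_pos j.2

theorem chainComp_injective {f : (j : ℕ) → Matrix (Fin (β j)) (Fin (β (j + 1))) F}
    (hf : ∀ j, Function.Injective (f j).mulVecLin) :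
    ∀ j, Function.Injective (chainComp f j).mulVecLin
  | 0 => by simpa [chainComp] using Function.injective_id
  | j + 1 => mul_injective (chainComp_injective hf j) (hf j)

theorem chainComp_intertwining {f : (j : ℕ) → Matrix (Fin (β j)) (Fin (β (j + 1))) F}
    {G : (j : ℕ) → GL (Fin (β j)) F}
    (h : ∀ j, (G j).val * f j = f j * (G (j + 1)).val) :
    ∀ j, (G 0).val * chainComp f j = chainComp f j * (G j).val
  | 0 => by simp [chainComp]
  | j + 1 => by
    rw [chainComp, ← Matrix.mul_assoc, chainComp_intertwining h j, Matrix.mul_assoc, h,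
      Matrix.mul_assoc]

/-- The `g`-stable flags in `F ^ n` whose dimensions are given by `β`. -/
abbrev StableFlag (n : ℕ) (β : ℕ → ℕ) (g : GL (Fin n) F) : Type :=
  {V : ℕ → Submodule F (Fin n → F) //
      V 0 = ⊤ ∧ (∀ j, V (j + 1) ≤ V j) ∧ (∀ j, Module.finrank F (V j) = β j) ∧
      (∀ j, ∀ v ∈ V j, Matrix.mulVecLin (g : Matrix (Fin n) (Fin n) F) v ∈ V j)}

/-- Chains of injective matrices intertwining the tuple `G`. -/
abbrev Chain (l : ℕ) (G : (j : ℕ) → GL (Fin (β j)) F) : Type :=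
  {f : (j : Fin l) → Matrix (Fin (β j.1)) (Fin (β (j.1 + 1))) F //
    (∀ j, Function.Injective (Matrix.mulVecLin (f j))) ∧
    (∀ j : Fin l, (G j.1 : Matrix (Fin (β j.1)) (Fin (β j.1)) F) * f j
        = f j * (G (j.1 + 1) : Matrix (Fin (β (j.1 + 1))) (Fin (β (j.1 + 1))) F))}

/-- The summand of `HC` attached to a flag. -/
noncomputable def flagTerm {n : ℕ} (l : ℕ) (γ : ℕ → (Fˣ →* ℂˣ)) {g : GL (Fin n) F}
    (V : StableFlag n β g) : ℂ :=
  ∏ j ∈ Finset.range (l + 1),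
    χap (γ j) (quotDet (Matrix.mulVecLin (g : Matrix (Fin n) (Fin n) F))
      (V.1 j) (V.1 (j + 1)))

/-- The value `ρ(g, g_1, …, g_l)`. -/
noncomputable def rho (l : ℕ) (γ : ℕ → (Fˣ →* ℂˣ)) (g : GL (Fin (β 0)) F)
    (gs : (j : Fin l) → GL (Fin (β (j.1 + 1))) F) : ℂ :=
  ((γ 0 (Matrix.GeneralLinearGroup.det g) : ℂˣ) : ℂ) *
    ∏ j : Fin l, (((γ (j.1 + 1) * (γ j.1)⁻¹) (Matrix.GeneralLinearGroup.det (gs j)) : ℂˣ) : ℂ)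

theorem extF_injective {l : ℕ} (hβ : ∀ j, l < j → β j = 0)
    {f : (j : Fin l) → Matrix (Fin (β j.1)) (Fin (β (j.1 + 1))) F}
    (hf : ∀ j, Function.Injective (Matrix.mulVecLin (f j))) (j : ℕ) :
    Function.Injective (extF l f j).mulVecLin := by
  by_cases h : j < l
  · simpa only [extF, dif_pos h] using hf ⟨j, h⟩
  · have : IsEmpty (Fin (β (j + 1))) := by
      rw [hβ (j + 1) (by omega)]
      infer_instance
    exact Function.injective_of_subsingleton _

theorem extF_intertwining {l : ℕ}
    {f : (j : Fin l) → Matrix (Fin (β j.1)) (Fin (β (j.1 + 1))) F}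
    {G : (j : ℕ) → GL (Fin (β j)) F}
    (h : ∀ j : Fin l, (G j.1).val * f j = f j * (G (j.1 + 1)).val) (j : ℕ) :
    (G j).val * extF l f j = extF l f j * (G (j + 1)).val := by
  by_cases hj : j < l
  · simpa only [extF, dif_pos hj] using h ⟨j, hj⟩
  · simp [extF, dif_neg hj]

/-- The flag of images of the composites of a chain. -/
noncomputable def flagOfChain {l : ℕ} (hβ : ∀ j, l < j → β j = 0) (g : GL (Fin (β 0)) F)
    (gs : (j : Fin l) → GL (Fin (β (j.1 + 1))) F) (f : Chain l (extG F l β g gs)) :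
    StableFlag (β 0) β g :=
  ⟨fun j => LinearMap.range (chainComp (extF l f.1) j).mulVecLin, by
    refine ⟨by simp [chainComp], fun j => range_mul_le _ _, fun j => ?_, fun j => ?_⟩
    · rw [LinearMap.finrank_range_of_inj
        (chainComp_injective (extF_injective hβ f.2.1) j), Module.finrank_fin_fun]
    · rintro _ ⟨v, rfl⟩
      have h := chainComp_intertwining (extF_intertwining f.2.2) j
      refine ⟨(extG F l β g gs j).val *ᵥ v, ?_⟩
      simpa [extG] using congrArg (· *ᵥ v) h.symm⟩

theorem flagTerm_flagOfChain {l : ℕ} (hβ : ∀ j, l < j → β j = 0) (γ : ℕ → (Fˣ →* ℂˣ))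
    (g : GL (Fin (β 0)) F) (gs : (j : Fin l) → GL (Fin (β (j.1 + 1))) F)
    (f : Chain l (extG F l β g gs)) :
    flagTerm l γ (flagOfChain hβ g gs f) = rho l γ g gs := by
  have hinj := chainComp_injective (extF_injective hβ f.2.1)
  have hint := chainComp_intertwining (extF_intertwining f.2.2)
  have key : ∀ j, χap (γ j) (quotDet (Matrix.mulVecLin g.val)
      ((flagOfChain hβ g gs f).1 j) ((flagOfChain hβ g gs f).1 (j + 1))) =
      (γ j (Matrix.GeneralLinearGroup.det (extG F l β g gs j)) : ℂ) *
        ((γ j (Matrix.GeneralLinearGroup.det (extG F l β g gs (j + 1))))⁻¹ : ℂˣ) := fun j =>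
    χap_of_mul_eq _ <| quotDet_mul_det _ _ _ (hinj j) (hinj (j + 1)) (range_mul_le _ _) _ _
      (fun x => by simpa [extG] using congrArg (· *ᵥ x) (hint j))
      (fun x => by simpa [extG] using congrArg (· *ᵥ x) (hint (j + 1)))
  have hlast : extG F l β g gs (l + 1) = 1 := by simp [extG]
  rw [flagTerm, Finset.prod_congr rfl fun j _ => key j, Finset.prod_mul_distrib,
    Finset.prod_range_succ', Finset.prod_range_succ (fun j => (((γ j _)⁻¹ : ℂˣ) : ℂ)), hlast]
  simp only [map_one, inv_one, Units.val_one, mul_one]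
  rw [mul_right_comm, ← Finset.prod_mul_distrib, mul_comm, Finset.prod_range, rho]
  simp only [extG_of_fin, MonoidHom.mul_apply, MonoidHom.inv_apply, Units.val_mul]
  rfl

/-- A chain is determined by its composites, and so is the tuple it intertwines. -/
theorem chain_ext {l : ℕ} (hβ : ∀ j, l < j → β j = 0) (g : GL (Fin (β 0)) F)
    (x y : (gs : (j : Fin l) → GL (Fin (β (j.1 + 1))) F) × Chain l (extG F l β g gs))
    (h : ∀ j : Fin l, chainComp (extF l x.2.1) (j + 1) = chainComp (extF l y.2.1) (j + 1)) :
    x = y := by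
  obtain ⟨gs, f⟩ := x
  obtain ⟨gs', f'⟩ := y
  have hinj := chainComp_injective (extF_injective hβ f.2.1)
  have h' : ∀ j, j ≤ l → chainComp (extF l f.1) j = chainComp (extF l f'.1) j
    | 0, _ => rfl
    | j + 1, hj => h ⟨j, hj⟩
  have hgs : gs = gs' := by
    funext j
    apply Units.ext
    apply mul_left_cancel_of_injective (hinj (j + 1))
    have h1 := chainComp_intertwining (extF_intertwining f.2.2) (j + 1)
    have h2 := chainComp_intertwining (extF_intertwining f'.2.2) (j + 1)
    rw [extG_of_fin] at h1 h2
    rw [← h1, h' _ j.2, ← h2]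
    rfl
  subst hgs
  have hf : f = f' := by
    apply Subtype.ext
    funext j
    apply mul_left_cancel_of_injective (hinj j)
    have := h j
    rwa [chainComp, chainComp, extF_of_fin, extF_of_fin, ← h' j j.2.le] at this
  rw [hf]

/-- Every compatible family of bases of the members of a stable flag comes from a chain. -/
theorem exists_chain {l : ℕ} (g : GL (Fin (β 0)) F)
    (E : (j : ℕ) → Matrix (Fin (β 0)) (Fin (β j)) F) (hE0 : E 0 = 1)
    (hinj : ∀ j, Function.Injective (E j).mulVecLin)
    (hle : ∀ j, LinearMap.range (E (j + 1)).mulVecLin ≤ LinearMap.range (E j).mulVecLin)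
    (hg : ∀ j, ∀ v ∈ LinearMap.range (E j).mulVecLin,
      g.val.mulVecLin v ∈ LinearMap.range (E j).mulVecLin) :
    ∃ x : (gs : (j : Fin l) → GL (Fin (β (j.1 + 1))) F) × Chain l (extG F l β g gs),
      ∀ j ≤ l, chainComp (extF l x.2.1) j = E j := by
  choose G hG using fun j => exists_gl_intertwining g (hinj j) (hg j)
  choose f hf using fun j => exists_mul_eq_of_range_le (E j) (E (j + 1)) (hle j)
  have hG0 : G 0 = g := by
    have h := hG 0
    rw [hE0, Matrix.mul_one, Matrix.one_mul] at h
    exact (Units.ext h).symm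
  have hext : ∀ j ≤ l, extG F l β g (fun j : Fin l => G (j + 1)) j = G j
    | 0, _ => hG0.symm
    | j + 1, hj => dif_pos hj
  refine ⟨⟨fun j => G (j + 1), fun j => f j, fun j => ?_, fun j => ?_⟩, ?_⟩
  · exact injective_of_mul_injective (A := E j) ((hf j).symm ▸ hinj (j + 1))
  · rw [hext _ j.2.le, hext _ j.2]
    apply mul_left_cancel_of_injective (hinj j)
    rw [← Matrix.mul_assoc, ← hG, Matrix.mul_assoc, hf, hG, ← Matrix.mul_assoc, hf]
  · intro j hj
    induction j with
    | zero => exact hE0.symm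
    | succ j ih =>
      rw [chainComp, ih (by omega), extF, dif_pos (Nat.lt_of_succ_le hj)]
      exact hf j

/-- Choosing reference bases identifies chains with flags together with changes of basis. -/
theorem exists_bijective_chain {l : ℕ} (hβ : ∀ j, l < j → β j = 0) (g : GL (Fin (β 0)) F) :
    ∃ Ψ : ((gs : (j : Fin l) → GL (Fin (β (j.1 + 1))) F) × Chain l (extG F l β g gs)) →
        StableFlag (β 0) β g × ((j : Fin l) → GL (Fin (β (j.1 + 1))) F),
      Function.Bijective Ψ ∧ ∀ x, (Ψ x).1 = flagOfChain hβ g x.1 x.2 := by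
  choose b hb hbV using fun (V : StableFlag (β 0) β g) (j : ℕ) =>
    exists_matrix_range_eq (β j) (V.1 j) (V.2.2.2.1 j)
  have ha : ∀ (x : (gs : (j : Fin l) → GL (Fin (β (j.1 + 1))) F) × Chain l (extG F l β g gs))
      (j : Fin l), ∃ a : GL (Fin (β (j.1 + 1))) F,
      b (flagOfChain hβ g x.1 x.2) (j + 1) * a.val =
        chainComp (extF l x.2.1) (j + 1) := by
    intro x j
    obtain ⟨C, hC⟩ := exists_mul_eq_of_range_le (b (flagOfChain hβ g x.1 x.2) (j + 1))
      (chainComp (extF l x.2.1) (j + 1)) (by rw [hbV]; rfl)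
    obtain ⟨a, rfl⟩ := exists_gl_of_injective (injective_of_mul_injective
      (hC ▸ chainComp_injective (extF_injective hβ x.2.2.1) (j + 1)))
    exact ⟨a, hC⟩
  choose a ha using ha
  refine ⟨fun x => (flagOfChain hβ g x.1 x.2, a x), ⟨fun x y hxy => ?_, fun ⟨V, c⟩ => ?_⟩,
    fun _ => rfl⟩
  · obtain ⟨h1, h2⟩ := Prod.mk.inj hxy
    exact chain_ext hβ g x y fun j => by rw [← ha, ← ha, h1, h2]
  · let E : (j : ℕ) → Matrix (Fin (β 0)) (Fin (β j)) F := fun j => match j with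
      | 0 => 1
      | j + 1 => b V (j + 1) * (if h : j < l then c ⟨j, h⟩ else 1 : GL (Fin (β (j + 1))) F).val
    have hEV : ∀ j, LinearMap.range (E j).mulVecLin = V.1 j
      | 0 => by simp [E, V.2.1]
      | j + 1 => by rw [← hbV]; exact range_mul_gl _ _
    have hE : ∀ j, Function.Injective (E j).mulVecLin
      | 0 => by simpa [E] using Function.injective_id
      | j + 1 => mul_injective (hb V _) (injective_of_gl _)
    obtain ⟨x, hx⟩ := exists_chain (l := l) g E rfl hE
      (fun j => by rw [hEV, hEV]; exact V.2.2.1 j)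
      (fun j => by rw [hEV]; exact V.2.2.2.2 j)
    have hxV : flagOfChain hβ g x.1 x.2 = V := by
      apply Subtype.ext
      funext j
      by_cases hj : j ≤ l
      · rw [← hEV, ← hx j hj]
        rfl
      · have h1 := (flagOfChain hβ g x.1 x.2).2.2.2.1 j
        have h2 := V.2.2.2.1 j
        rw [hβ j (by omega), Submodule.finrank_eq_zero] at h1 h2
        rw [h1, h2]
    refine ⟨x, Prod.ext hxV ?_⟩
    funext j
    apply Units.ext
    apply mul_left_cancel_of_injective (hb V (j + 1))
    have := ha x j
    rw [hxV, hx _ j.2] at this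
    simpa [E] using this

theorem HC_mul_card [Fintype F] {l : ℕ} (hβ : ∀ j, l < j → β j = 0) (γ : ℕ → (Fˣ →* ℂˣ))
    (g : GL (Fin (β 0)) F) :
    (Nat.card ((j : Fin l) → GL (Fin (β (j.1 + 1))) F) : ℂ) * HC F (β 0) l β γ g =
      ∑ᶠ gs : (j : Fin l) → GL (Fin (β (j.1 + 1))) F,
        (Nat.card (Chain l (extG F l β g gs)) : ℂ) * rho l γ g gs := by
  classical
  obtain ⟨Ψ, hΨ, hfst⟩ := exists_bijective_chain hβ g
  have : Finite (StableFlag (β 0) β g) :=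
    Finite.of_surjective (fun x => (Ψ x).1) (Prod.fst_surjective.comp hΨ.2)
  have := Fintype.ofFinite (StableFlag (β 0) β g)
  have hHC : HC F (β 0) l β γ g = ∑ V : StableFlag (β 0) β g, flagTerm l γ V :=
    finsum_eq_sum_of_fintype _
  rw [hHC, finsum_eq_sum_of_fintype, Nat.card_eq_fintype_card]
  calc _ = ∑ y : StableFlag (β 0) β g × ((j : Fin l) → GL (Fin (β (j.1 + 1))) F),
        flagTerm l γ y.1 := by
        simp [Fintype.sum_prod_type, Finset.mul_sum]
    _ = ∑ x : (gs : (j : Fin l) → GL (Fin (β (j.1 + 1))) F) × Chain l (extG F l β g gs),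
        rho l γ g x.1 := by
        refine (Fintype.sum_bijective Ψ hΨ _ _ fun x => ?_).symm
        rw [hfst, flagTerm_flagOfChain]
    _ = _ := by
        simp [Fintype.sum_sigma, Nat.card_eq_fintype_card]

theorem Ncount_eq (m l : ℕ) (G : (j : ℕ) → GL (Fin (β j)) F) :
    Ncount F m l β G = Λcount F (β 0) m (G 0) * Nat.card (Chain l G) := by
  rw [Ncount, Λcount, ← Nat.card_prod]
  exact Nat.card_congr (Equiv.subtypeProdEquivProd
    (p := fun A : Fin m → Matrix (Fin (β 0)) (Fin (β 0)) F =>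
      ∀ r, (G 0).val * A r = A r * (G 0).val)
    (q := fun f : (j : Fin l) → Matrix (Fin (β j.1)) (Fin (β (j.1 + 1))) F =>
      (∀ j, Function.Injective (Matrix.mulVecLin (f j))) ∧
        ∀ j : Fin l, (G j.1).val * f j = f j * (G (j.1 + 1)).val))

end Chains

end QRep

open QRep in
/-- For `g ∈ GL_n(𝔽_q)`,
`Λ_m(g) · R(γ_0,…,γ_l)(g) = (1/∏_j |GL_{β_j}(𝔽_q)|) · Σ_{(g_1,…,g_l)} N(g,g_1,…,g_l) ·
ρ(g,g_1,…,g_l)`, where `R` is the Harish-Chandra induced character, `N` counts commuting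
tuples of matrices together with intertwining injective maps along the chain, and
`ρ(g, g_1,…,g_l) = γ_0(det g) · ∏_{j=1}^{l} (γ_j γ_{j-1}^{-1})(det g_j)`. -/
theorem statement5 (F : Type) [Field F] [Fintype F] (l m : ℕ) (nn : ℕ → ℕ)
    (β : ℕ → ℕ) (hβ : β = fun j => ∑ h ∈ Finset.Icc j l, nn h)
    (γ : ℕ → (Fˣ →* ℂˣ)) (g : GL (Fin (β 0)) F) :
    (Λcount F (β 0) m g : ℂ) * HC F (β 0) l β γ g =
      (Nat.card ((j : Fin l) → GL (Fin (β (j.1 + 1))) F) : ℂ)⁻¹ *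
        ∑ᶠ gs : (j : Fin l) → GL (Fin (β (j.1 + 1))) F,
          (Ncount F m l β (extG F l β g gs) : ℂ) *
            (((γ 0 (Matrix.GeneralLinearGroup.det g) : ℂˣ) : ℂ) *
              ∏ j : Fin l,
                (((γ (j.1 + 1) * (γ j.1)⁻¹)
                  (Matrix.GeneralLinearGroup.det (gs j)) : ℂˣ) : ℂ)) := by
  have hβ' : ∀ j, l < j → β j = 0 := fun j hj => by simp [hβ, Finset.Icc_eq_empty_of_lt hj]
  have hcard : (Nat.card ((j : Fin l) → GL (Fin (β (j.1 + 1))) F) : ℂ) ≠ 0 :=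
    Nat.cast_ne_zero.2 Nat.card_pos.ne'
  rw [eq_inv_mul_iff_mul_eq₀ hcard, mul_left_comm, HC_mul_card hβ', mul_finsum]
  refine finsum_congr fun gs => ?_
  rw [Ncount_eq, Nat.cast_mul, mul_assoc]
  rfl
end

section
/- With the star-shaped quiver data fixed, let R*_α(g), for g ∈ GL_α(𝔽_q), be the number of representations x ∈ R(Q,α)(𝔽_q) fixed by g all of whose matrices on the leg arrows [i,j] → [i,j−1] are injective, and let ρ_σ(g) = ∏_{i∈I} σ_i(det g_i). Then (1/|GL_α(𝔽_q)|) · Σ_{g ∈ GL_α(𝔽_q)} R*_α(g) · ρ_σ(g) = (1/|GL_n(𝔽_q)|) · Σ_{h ∈ GL_n(𝔽_q)} Λ_m(h) · ∏_{i=1}^k R(γ_i)(h). -/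
open Matrix

namespace QRep

variable {I Ω : Type} (src tgt : Ω → I)

/-- A representation of the quiver with arrow set `Ω`, tail map `src`, head map `tgt`,
of dimension vector `β`, over the field `K`: a matrix of size `β (tgt a) × β (src a)`
for every arrow `a`. -/
def Rep (K : Type) [Field K] (β : I → ℕ) : Type :=
  ∀ a : Ω, Matrix (Fin (β (tgt a))) (Fin (β (src a))) K

/-- Isomorphism of representations (of possibly different dimension vectors). -/
def RepIso {K : Type} [Field K] {β γ : I → ℕ} (x : Rep src tgt K β) (y : Rep src tgt K γ) :
    Prop :=
  ∃ e : ∀ i, (Fin (β i) → K) ≃ₗ[K] (Fin (γ i) → K),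
    ∀ a : Ω, (Matrix.mulVecLin (y a)).comp (e (src a) : (Fin (β (src a)) → K) →ₗ[K] _)
      = ((e (tgt a) : (Fin (β (tgt a)) → K) →ₗ[K] _)).comp (Matrix.mulVecLin (x a))

/-- Direct sum (block diagonal) of two representations. -/
def dsum {K : Type} [Field K] {β γ : I → ℕ} (x : Rep src tgt K β) (y : Rep src tgt K γ) :
    Rep src tgt K (β + γ) :=
  fun a => Matrix.reindex finSumFinEquiv finSumFinEquiv (Matrix.fromBlocks (x a) 0 0 (y a))

/-- A representation is indecomposable if its dimension vector is nonzero and it is not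
isomorphic to a direct sum of two representations of nonzero dimension vectors. -/
def Indec {K : Type} [Field K] {β : I → ℕ} (x : Rep src tgt K β) : Prop :=
  β ≠ 0 ∧ ∀ (β₁ β₂ : I → ℕ) (y : Rep src tgt K β₁) (z : Rep src tgt K β₂),
    β₁ ≠ 0 → β₂ ≠ 0 → ¬ RepIso src tgt x (dsum src tgt y z)

/-- Base change of a representation along a ring homomorphism of fields. -/
def baseChange {K L : Type} [Field K] [Field L] (f : K →+* L) {β : I → ℕ}
    (x : Rep src tgt K β) : Rep src tgt L β :=
  fun a => (x a).map f

/-- `x` is of level at most `V`: every indecomposable direct summand of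
`x ⊗ K̄` has dimension vector belonging to `V`. -/
def LevelAtMost {K : Type} [Field K] {β : I → ℕ} (x : Rep src tgt K β)
    (V : Set (I → ℕ)) : Prop :=
  ∀ (γ δ : I → ℕ) (Y : Rep src tgt (AlgebraicClosure K) γ)
    (z : Rep src tgt (AlgebraicClosure K) δ), Indec src tgt Y →
    RepIso src tgt (baseChange src tgt (algebraMap K (AlgebraicClosure K)) x)
      (dsum src tgt Y z) → γ ∈ V

/-- The action of `GL_β(K)` on representations of dimension vector `β`. -/
def glAct {K : Type} [Field K] {β : I → ℕ} (g : ∀ i, GL (Fin (β i)) K)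
    (x : Rep src tgt K β) : Rep src tgt K β :=
  fun a => ((g (tgt a) : Matrix (Fin (β (tgt a))) (Fin (β (tgt a))) K) * x a) *
    (((g (src a))⁻¹ : GL (Fin (β (src a))) K) : Matrix (Fin (β (src a))) (Fin (β (src a))) K)

/-- The number of `GL_β(K)`-orbits of representations of dimension vector `β`
satisfying the property `P`. -/
noncomputable def orbitCount {K : Type} [Field K] (β : I → ℕ)
    (P : Rep src tgt K β → Prop) : ℕ :=
  Nat.card (Quot fun x y : {x : Rep src tgt K β // P x} =>
    ∃ g : ∀ i, GL (Fin (β i)) K, glAct src tgt g x.1 = y.1)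


open scoped Classical

/-- Vertices of the star-shaped quiver: `none` is the central vertex `0`, and
`some ⟨i, j⟩` is the vertex `[i, j+1]` on leg `i` (so `j : Fin (s i)` runs through the
leg vertices `[i,1], …, [i, s_i]`). -/
abbrev StarV (k : ℕ) (s : Fin k → ℕ) := Option ((i : Fin k) × Fin (s i))

/-- Arrows of the star-shaped quiver: `m` loops at the central vertex together with, for
each leg `i` and each `j`, one arrow `[i, j+1] → [i, j]`. -/
abbrev StarA (k m : ℕ) (s : Fin k → ℕ) := Fin m ⊕ ((i : Fin k) × Fin (s i))

/-- The vertex `[i, j]` preceding `[i, j+1]` on a leg (the central vertex if `j = 0`). -/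
def legPrev (k : ℕ) (s : Fin k → ℕ) (a : (i : Fin k) × Fin (s i)) : StarV k s :=
  if h : a.2.1 = 0 then none
  else some ⟨a.1, ⟨a.2.1 - 1, lt_of_le_of_lt (Nat.pred_le _) a.2.2⟩⟩

/-- Tail map of the star-shaped quiver. -/
def starSrc (k m : ℕ) (s : Fin k → ℕ) : StarA k m s → StarV k s
  | .inl _ => none
  | .inr a => some a

/-- Head map of the star-shaped quiver. -/
def starTgt (k m : ℕ) (s : Fin k → ℕ) : StarA k m s → StarV k s
  | .inl _ => none
  | .inr a => legPrev k s a

/-- A dimension vector is non-increasing along each leg. -/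
def NonIncr (k : ℕ) (s : Fin k → ℕ) (δ : StarV k s → ℕ) : Prop :=
  ∀ a : (i : Fin k) × Fin (s i), δ (some a) ≤ δ (legPrev k s a)

/-- `legβ k s nn i j = n_{i,j} + n_{i,j+1} + ⋯ + n_{i,s_i}`. -/
def legβ (k : ℕ) (s : Fin k → ℕ) (nn : Fin k → ℕ → ℕ) (i : Fin k) (j : ℕ) : ℕ :=
  ∑ h ∈ Finset.Icc j (s i), nn i h

/-- The dimension vector `α`: `α_0 = n`, `α_{[i,j]} = n_{i,j} + ⋯ + n_{i,s_i}`. -/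
def starα (k n : ℕ) (s : Fin k → ℕ) (nn : Fin k → ℕ → ℕ) : StarV k s → ℕ
  | none => n
  | some a => legβ k s nn a.1 (a.2.1 + 1)

/-- The tuple `σ`: `σ_0 = ∏_i γ_{i,0}` and `σ_{[i,j]} = γ_{i,j} γ_{i,j-1}^{-1}`. -/
noncomputable def starσ (F : Type) [Field F] (k : ℕ) (s : Fin k → ℕ)
    (γ : Fin k → ℕ → (Fˣ →* ℂˣ)) : StarV k s → (Fˣ →* ℂˣ)
  | none => ∏ i, γ i 0
  | some a => γ a.1 (a.2.1 + 1) * (γ a.1 a.2.1)⁻¹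


/-- The multiplicity `⟨Λ ⊗ R(γ_1) ⊗ ⋯ ⊗ R(γ_k), 1⟩ =
(1/|GL_n(𝔽_q)|) Σ_h Λ_m(h) ∏_i R(γ_i)(h)`. -/
noncomputable def mult (F : Type) [Field F] [Fintype F] (k m n : ℕ) (s : Fin k → ℕ)
    (nn : Fin k → ℕ → ℕ) (γ : Fin k → ℕ → (Fˣ →* ℂˣ)) : ℂ :=
  (Nat.card (GL (Fin n) F) : ℂ)⁻¹ *
    ∑ᶠ h : GL (Fin n) F,
      (Λcount F n m h : ℂ) * ∏ i : Fin k, HC F n (s i) (legβ k s nn i) (γ i) h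

end QRep

namespace Matrix

variable {F : Type} [Field F] {l m n : Type} [Fintype l] [Fintype m] [Fintype n]

omit [Fintype l] in
theorem mul_left_cancel_of_injective {y : Matrix l m F}
    (hy : Function.Injective y.mulVecLin) {a b : Matrix m n F} (h : y * a = y * b) : a = b := by
  classical
  refine Matrix.ext_of_mulVec_single fun i => hy ?_
  simp only [mulVecLin_apply, mulVec_mulVec, h]

omit [Fintype l] in
theorem exists_eq_mul_of_range_le {y : Matrix l m F} {z : Matrix l n F}
    (h : LinearMap.range z.mulVecLin ≤ LinearMap.range y.mulVecLin) :
    ∃ x : Matrix m n F, z = y * x := by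
  classical
  choose c hc using fun j : n => h (LinearMap.mem_range_self z.mulVecLin (Pi.single j 1))
  refine ⟨Matrix.of fun i j => c j i, Matrix.ext_of_mulVec_single fun j => ?_⟩
  rw [← mulVec_mulVec, ← mulVecLin_apply, ← hc j, mulVecLin_apply]
  congr 1
  ext i
  simp

theorem mulVecLin_unit_injective [DecidableEq n] (g : GL n F) :
    Function.Injective (mulVecLin (g : Matrix n n F)) :=
  mulVec_injective_iff_isUnit.2 g.isUnit

/-- If `y` intertwines `g` and `h` and is injective, then `det g` is the determinant of the
restriction of `h` to the range of `y`. -/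
theorem det_restrict_range_eq [DecidableEq n] {y : Matrix l n F}
    (hy : Function.Injective y.mulVecLin) {h : Matrix l l F} {g : Matrix n n F}
    (hg : h * y = y * g) {V : Submodule F (l → F)} (hV : LinearMap.range y.mulVecLin = V)
    (hs : ∀ v ∈ V, h.mulVecLin v ∈ V) :
    LinearMap.det (h.mulVecLin.restrict hs) = g.det := by
  subst hV
  have key : h.mulVecLin.restrict hs =
      (LinearEquiv.ofInjective _ hy : (n → F) →ₗ[F] _) ∘ₗ g.mulVecLin ∘ₗ
        ((LinearEquiv.ofInjective _ hy).symm : _ →ₗ[F] (n → F)) := by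
    refine LinearMap.ext fun v => ?_
    obtain ⟨w, rfl⟩ := (LinearEquiv.ofInjective _ hy).surjective v
    refine Subtype.ext ?_
    simp [LinearMap.restrict_apply, LinearEquiv.ofInjective_apply, hg]
  rw [key, LinearMap.det_conj, ← Matrix.toLin'_apply', LinearMap.det_toLin']

/-- The injective matrices with a prescribed range form a torsor under the general linear
group. -/
theorem card_injective_range_eq [DecidableEq n] (V : Submodule F (l → F))
    (hV : Module.finrank F V = Fintype.card n) :
    Nat.card {y : Matrix l n F // Function.Injective y.mulVecLin ∧
      LinearMap.range y.mulVecLin = V} = Nat.card (GL n F) := by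
  classical
  obtain ⟨e⟩ : Nonempty ((n → F) ≃ₗ[F] V) :=
    FiniteDimensional.nonempty_linearEquiv_of_finrank_eq (by simp [hV])
  obtain ⟨y₀, hy₀⟩ : ∃ y₀ : Matrix l n F, y₀.mulVecLin = V.subtype ∘ₗ e :=
    ⟨LinearMap.toMatrix' _, by rw [← Matrix.toLin'_apply', Matrix.toLin'_toMatrix']⟩
  have hinj : Function.Injective y₀.mulVecLin := by
    rw [hy₀]
    exact V.injective_subtype.comp e.injective
  have hrange : LinearMap.range y₀.mulVecLin = V := by
    rw [hy₀, LinearMap.range_comp]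
    simp
  have hmul (u : GL n F) : Function.Injective (y₀ * u.1).mulVecLin ∧
      LinearMap.range (y₀ * u.1).mulVecLin = V := by
    rw [mulVecLin_mul, LinearMap.range_comp, LinearMap.range_eq_top.2
      (LinearMap.injective_iff_surjective.1 (mulVecLin_unit_injective u)), Submodule.map_top]
    exact ⟨hinj.comp (mulVecLin_unit_injective u), hrange⟩
  refine (Nat.card_eq_of_bijective (fun u : GL n F => ⟨y₀ * u.1, hmul u⟩)
    ⟨fun u v huv => ?_, fun ⟨y, hy, hyV⟩ => ?_⟩).symm
  · exact Units.ext (mul_left_cancel_of_injective hinj (congrArg Subtype.val huv))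
  · obtain ⟨u, rfl⟩ := exists_eq_mul_of_range_le (hyV.trans hrange.symm).le
    have hu : IsUnit u := by
      rw [mulVecLin_mul, LinearMap.coe_comp] at hy
      exact mulVec_injective_iff_isUnit.1 hy.of_comp
    exact ⟨hu.unit, rfl⟩

end Matrix

namespace QRep

section Tree

variable {F : Type} [Field F] {A : Type} (p : A → Option A) (α : Option A → ℕ)

/-- For the tree with parent map `p`, the matrices `x` along the edges are injective and
commute with the action of `g` at the vertices. -/
def IsIntertwiner (g : ∀ v, GL (Fin (α v)) F)
    (x : ∀ a, Matrix (Fin (α (p a))) (Fin (α (some a))) F) : Prop :=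
  ∀ a, (g (p a)).1 * x a = x a * (g (some a)).1 ∧ Function.Injective (x a).mulVecLin

/-- An `h`-stable family of subspaces, decreasing along the tree with parent map `p`, of
dimensions prescribed by `α`. -/
def IsStableFlag (h : GL (Fin (α none)) F)
    (V : A → Submodule F (Fin (α none) → F)) : Prop :=
  ∀ a, V a ≤ (p a).elim ⊤ V ∧ Module.finrank F (V a) = α (some a) ∧
    ∀ v ∈ V a, h.1.mulVecLin v ∈ V a

/-- The determinant of `h` on a member of an `h`-stable flag. -/
noncomputable def flagDet {p : A → Option A} {α : Option A → ℕ} {h : GL (Fin (α none)) F}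
    (V : {V // IsStableFlag p α h V}) (a : A) : F :=
  LinearMap.det (h.1.mulVecLin.restrict (V.2 a).2.2)

variable {p α} (d : Option A → ℕ) (hd : ∀ a, d (p a) < d (some a))

/-- The composite of the matrices `x` along the path from a vertex to the root. -/
noncomputable def toRoot (d : Option A → ℕ) (hd : ∀ a, d (p a) < d (some a))
    (x : ∀ a, Matrix (Fin (α (p a))) (Fin (α (some a))) F) :
    ∀ v, Matrix (Fin (α none)) (Fin (α v)) F
  | none => 1
  | some a => toRoot d hd x (p a) * x a
termination_by v => d v
decreasing_by exact hd a

theorem toRoot_none (x : ∀ a, Matrix (Fin (α (p a))) (Fin (α (some a))) F) :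
    toRoot d hd x none = 1 := by
  rw [toRoot]

theorem toRoot_some (x : ∀ a, Matrix (Fin (α (p a))) (Fin (α (some a))) F) (a : A) :
    toRoot d hd x (some a) = toRoot d hd x (p a) * x a := by
  rw [toRoot]

include hd in
theorem tree_induction {P : Option A → Prop} (h0 : P none)
    (h1 : ∀ a, P (p a) → P (some a)) (v : Option A) : P v := by
  induction hn : d v using Nat.strong_induction_on generalizing v with
  | _ N ih =>
    cases v with
    | none => exact h0
    | some a => exact h1 a (ih _ (hn ▸ hd a) _ rfl)

theorem toRoot_injective {g : ∀ v, GL (Fin (α v)) F}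
    {x : ∀ a, Matrix (Fin (α (p a))) (Fin (α (some a))) F} (hx : IsIntertwiner p α g x)
    (v : Option A) : Function.Injective (toRoot d hd x v).mulVecLin := by
  refine tree_induction d hd (P := fun v => Function.Injective (toRoot d hd x v).mulVecLin)
    ?_ (fun a ih => ?_) v
  · rw [toRoot_none, Matrix.mulVecLin_one]
    exact Function.injective_id
  · rw [toRoot_some, Matrix.mulVecLin_mul]
    exact ih.comp (hx a).2

theorem mul_toRoot {g : ∀ v, GL (Fin (α v)) F}
    {x : ∀ a, Matrix (Fin (α (p a))) (Fin (α (some a))) F} (hx : IsIntertwiner p α g x)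
    (v : Option A) : (g none).1 * toRoot d hd x v = toRoot d hd x v * (g v).1 := by
  refine tree_induction d hd
    (P := fun v => (g none).1 * toRoot d hd x v = toRoot d hd x v * (g v).1)
    ?_ (fun a ih => ?_) v
  · rw [toRoot_none, mul_one, one_mul]
  · rw [toRoot_some, ← Matrix.mul_assoc, ih, Matrix.mul_assoc, (hx a).1, Matrix.mul_assoc]

theorem isStableFlag_range_toRoot {g : ∀ v, GL (Fin (α v)) F}
    {x : ∀ a, Matrix (Fin (α (p a))) (Fin (α (some a))) F} (hx : IsIntertwiner p α g x) :
    IsStableFlag p α (g none)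
      fun a => LinearMap.range (toRoot d hd x (some a)).mulVecLin := by
  refine fun a => ⟨?_, ?_, ?_⟩
  · have h : LinearMap.range (toRoot d hd x (some a)).mulVecLin ≤
        LinearMap.range (toRoot d hd x (p a)).mulVecLin := by
      rw [toRoot_some, Matrix.mulVecLin_mul]
      exact LinearMap.range_comp_le_range _ _
    generalize p a = v at h
    cases v with
    | none => exact le_top
    | some b => exact h
  · rw [LinearMap.finrank_range_of_inj (toRoot_injective d hd hx _), Module.finrank_fin_fun]
  · rintro _ ⟨w, rfl⟩
    refine ⟨(g (some a)).1.mulVecLin w, ?_⟩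
    rw [← LinearMap.comp_apply, ← Matrix.mulVecLin_mul, ← mul_toRoot d hd hx,
      Matrix.mulVecLin_mul, LinearMap.comp_apply]

/-- A stable flag together with a matrix parametrising each of its members. -/
abbrev ParamFlag (p : A → Option A) (α : Option A → ℕ) (F : Type) [Field F] : Type :=
  Σ t : (Σ h : GL (Fin (α none)) F, {V // IsStableFlag p α h V}), ∀ a,
    {y : Matrix (Fin (α none)) (Fin (α (some a))) F //
      Function.Injective y.mulVecLin ∧ LinearMap.range y.mulVecLin = t.2.1 a}

theorem ParamFlag.ext {t u : ParamFlag p α F} (h : t.1.1 = u.1.1)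
    (hy : ∀ a, (t.2 a).1 = (u.2 a).1) : t = u := by
  obtain ⟨⟨g, V, hV⟩, y⟩ := t
  obtain ⟨⟨g', V', hV'⟩, y'⟩ := u
  obtain rfl : g = g' := h
  obtain rfl : V = V' := funext fun a => ((y a).2.2.symm.trans
    (congrArg (fun z => LinearMap.range (Matrix.mulVecLin z)) (hy a))).trans (y' a).2.2
  obtain rfl : y = y' := funext fun a => Subtype.ext (hy a)
  rfl

/-- The parametrised flag of images in the root of an intertwiner. -/
noncomputable def toParamFlag (d : Option A → ℕ) (hd : ∀ a, d (p a) < d (some a))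
    (t : Σ g : ∀ v, GL (Fin (α v)) F, {x // IsIntertwiner p α g x}) : ParamFlag p α F :=
  ⟨⟨t.1 none, _, isStableFlag_range_toRoot d hd t.2.2⟩, fun a =>
    ⟨toRoot d hd t.2.1 (some a), toRoot_injective d hd t.2.2 _, rfl⟩⟩

theorem toParamFlag_injective :
    Function.Injective (toParamFlag (F := F) (α := α) d hd) := by
  rintro ⟨g, x, hx⟩ ⟨g', x', hx'⟩ h
  have hroot : g none = g' none := congrArg (fun t => t.1.1) h
  have hy : ∀ v, toRoot d hd x v = toRoot d hd x' v := by
    rintro (_ | a)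
    · rw [toRoot_none, toRoot_none]
    · exact congrArg (fun t : ParamFlag p α F => (t.2 a).1) h
  obtain rfl : g = g' := funext fun v => Units.ext <|
    Matrix.mul_left_cancel_of_injective (toRoot_injective d hd hx v) <| by
      rw [← mul_toRoot d hd hx, hy, hroot, mul_toRoot d hd hx']
  obtain rfl : x = x' := funext fun a =>
    Matrix.mul_left_cancel_of_injective (toRoot_injective d hd hx (p a)) <| by
      rw [← toRoot_some, hy, hy, toRoot_some]
  rfl

theorem toParamFlag_surjective :
    Function.Surjective (toParamFlag (F := F) (α := α) d hd) := by
  rintro ⟨⟨h, V, hV⟩, y⟩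
  let z : ∀ v, Matrix (Fin (α none)) (Fin (α v)) F := fun v =>
    match v with
    | none => 1
    | some a => (y a).1
  have hz : ∀ v, Function.Injective (z v).mulVecLin := by
    rintro (_ | a)
    · simpa [z] using Function.injective_id
    · exact (y a).2.1
  have hrange : ∀ v, LinearMap.range (z v).mulVecLin = v.elim ⊤ V := by
    rintro (_ | a)
    · simp [z]
    · exact (y a).2.2
  have hstable : ∀ v : Option A, ∀ w ∈ v.elim ⊤ V, h.1.mulVecLin w ∈ v.elim ⊤ V := by
    rintro (_ | a)
    · exact fun _ _ => trivial
    · exact (hV a).2.2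
  have hg : ∀ v, ∃ g : GL (Fin (α v)) F, h.1 * z v = z v * g.1 := by
    intro v
    obtain ⟨u, hu⟩ := Matrix.exists_eq_mul_of_range_le (y := z v) (z := h.1 * z v) <| by
      rintro _ ⟨w, rfl⟩
      rw [Matrix.mulVecLin_mul, LinearMap.comp_apply, hrange]
      exact hstable v _ (hrange v ▸ LinearMap.mem_range_self _ _)
    have hinj : Function.Injective (z v * u).mulVecLin := by
      rw [← hu, Matrix.mulVecLin_mul]
      exact (Matrix.mulVecLin_unit_injective h).comp (hz v)
    rw [Matrix.mulVecLin_mul, LinearMap.coe_comp] at hinj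
    exact ⟨(Matrix.mulVec_injective_iff_isUnit.1 hinj.of_comp).unit, hu⟩
  choose g hg using hg
  have hx : ∀ a, ∃ x : Matrix (Fin (α (p a))) (Fin (α (some a))) F,
      z (some a) = z (p a) * x := fun a =>
    Matrix.exists_eq_mul_of_range_le (by rw [hrange, hrange]; exact (hV a).1)
  choose x hx using hx
  have hroot : g none = h := Units.ext (by simpa [z] using (hg none).symm)
  have hgx : IsIntertwiner p α g x := by
    refine fun a => ⟨Matrix.mul_left_cancel_of_injective (hz (p a)) ?_, ?_⟩
    · rw [← Matrix.mul_assoc, ← hg, Matrix.mul_assoc, ← hx, hg (some a), hx, Matrix.mul_assoc]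
    · have := hz (some a)
      rw [hx, Matrix.mulVecLin_mul, LinearMap.coe_comp] at this
      exact this.of_comp
  have hy : ∀ v, toRoot d hd x v = z v := fun v =>
    tree_induction d hd (P := fun v => toRoot d hd x v = z v) (toRoot_none d hd x)
      (fun a ih => by rw [toRoot_some, ih, hx]) v
  exact ⟨⟨g, x, hgx⟩, ParamFlag.ext hroot fun a => hy (some a)⟩

include hd in
/-- Counting intertwiners on a tree with injective edge maps, weighted by a function of the
root component and of the determinants at the other vertices, amounts to counting stable
flags at the root. -/
theorem finsum_card_isIntertwiner [Finite F] [Finite A]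
    (W : GL (Fin (α none)) F → (A → F) → ℂ) :
    ∑ᶠ g : ∀ v, GL (Fin (α v)) F, (Nat.card {x // IsIntertwiner p α g x} : ℂ) *
        W (g none) (fun a => (g (some a)).1.det) =
      Nat.card (∀ a, GL (Fin (α (some a))) F) *
        ∑ᶠ h : GL (Fin (α none)) F, ∑ᶠ V : {V // IsStableFlag p α h V}, W h (flagDet V) := by
  classical
  have := Fintype.ofFinite F
  have := Fintype.ofFinite A
  have (g : ∀ v, GL (Fin (α v)) F) : Fintype {x // IsIntertwiner p α g x} :=
    Fintype.ofFinite _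
  have (h : GL (Fin (α none)) F) : Fintype {V // IsStableFlag p α h V} := Fintype.ofFinite _
  simp only [finsum_eq_sum_of_fintype]
  calc _ = ∑ t : Σ g : ∀ v, GL (Fin (α v)) F, {x // IsIntertwiner p α g x},
        W (t.1 none) fun a => (t.1 (some a)).1.det := by
        rw [Fintype.sum_sigma]
        simp
    _ = ∑ u : ParamFlag p α F, W u.1.1 (flagDet u.1.2) := by
        refine Fintype.sum_bijective (toParamFlag d hd)
          ⟨toParamFlag_injective d hd, toParamFlag_surjective d hd⟩ _ _ fun t => ?_
        refine congrArg (W (t.1 none)) (funext fun a => ?_)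
        exact (Matrix.det_restrict_range_eq (toRoot_injective d hd t.2.2 (some a))
          (mul_toRoot d hd t.2.2 (some a)) rfl _).symm
    _ = _ := by
        rw [Fintype.sum_sigma, ← Fintype.sum_sigma fun t : Σ h, {V // IsStableFlag p α h V} =>
          W t.1 (flagDet t.2), Finset.mul_sum]
        refine Finset.sum_congr rfl fun t _ => ?_
        refine (Finset.sum_const (W t.1 (flagDet t.2))).trans ?_
        rw [Finset.card_univ, nsmul_eq_mul, ← Nat.card_eq_fintype_card]
        congr 2
        rw [Nat.card_pi, Nat.card_pi]
        refine Finset.prod_congr rfl fun a _ => ?_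
        exact Matrix.card_injective_range_eq _ (by rw [(t.2.2 a).2.1, Fintype.card_fin])

end Tree

section Det

variable {F M : Type} [Field F] [AddCommGroup M] [Module F M]

theorem det_restrict_eq_mul_quotDet [FiniteDimensional F M] (T : M →ₗ[F] M)
    {W U : Submodule F M} (hUW : U ≤ W) (hW : ∀ x ∈ W, T x ∈ W) (hU : ∀ x ∈ U, T x ∈ U) :
    LinearMap.det (T.restrict hW) = LinearMap.det (T.restrict hU) * quotDet T W U := by
  have hc : U.comap W.subtype ≤ (U.comap W.subtype).comap (T.restrict hW) :=
    fun x hx => hU x.1 hx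
  rw [LinearMap.det_eq_det_mul_det (U.comap W.subtype) (T.restrict hW) hc, quotDet,
    dif_pos ⟨hW, hU⟩]
  congr 1
  rw [← LinearMap.det_conj ((T.restrict hW).restrict hc)
    (Submodule.comapSubtypeEquivOfLe hUW)]
  rfl

theorem χap_coe (χ : Fˣ →* ℂˣ) (u : Fˣ) : χap χ (u : F) = χ u := by
  rw [χap, dif_neg u.ne_zero, Units.mk0_val]

theorem prod_range_apply_div {G H : Type} [CommGroup G] [CommGroup H] (γ : ℕ → (G →* H))
    (D : ℕ → G) (l : ℕ) :
    ∏ j ∈ Finset.range (l + 1), γ j (D j / D (j + 1)) =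
      γ 0 (D 0) * (∏ j ∈ Finset.range l, (γ (j + 1) * (γ j)⁻¹) (D (j + 1))) *
        (γ l (D (l + 1)))⁻¹ := by
  induction l with
  | zero => simp [div_eq_mul_inv]
  | succ l ih =>
    rw [Finset.prod_range_succ, ih, Finset.prod_range_succ]
    simp only [MonoidHom.mul_apply, MonoidHom.inv_apply, map_div]
    rw [div_eq_mul_inv]
    simp only [mul_comm, mul_left_comm, mul_assoc]

end Det

section Flags

variable {F : Type} [Field F]

/-- The `g`-stable flags of dimensions `β` in `F ^ n`. -/
abbrev LegFlag {n : ℕ} (β : ℕ → ℕ) (g : GL (Fin n) F) : Type :=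
  {V : ℕ → Submodule F (Fin n → F) //
    V 0 = ⊤ ∧ (∀ j, V (j + 1) ≤ V j) ∧ (∀ j, Module.finrank F (V j) = β j) ∧
    (∀ j, ∀ v ∈ V j, Matrix.mulVecLin (g : Matrix (Fin n) (Fin n) F) v ∈ V j)}

theorem LegFlag.ext {n l : ℕ} {β : ℕ → ℕ} (hβ : ∀ j, l < j → β j = 0) {g : GL (Fin n) F}
    {V W : LegFlag β g} (h : ∀ j < l, V.1 (j + 1) = W.1 (j + 1)) : V = W := by
  refine Subtype.ext (funext fun j => ?_)
  rcases j with _ | j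
  · rw [V.2.1, W.2.1]
  · by_cases hj : j < l
    · exact h j hj
    · have h0 := hβ (j + 1) (by omega)
      rw [Submodule.finrank_eq_zero.1 ((V.2.2.2.1 _).trans h0),
        Submodule.finrank_eq_zero.1 ((W.2.2.2.1 _).trans h0)]

theorem LegFlag.finite [Finite F] {n l : ℕ} {β : ℕ → ℕ} (hβ : ∀ j, l < j → β j = 0)
    (g : GL (Fin n) F) : Finite (LegFlag β g) :=
  Finite.of_injective (fun V (j : Fin l) => V.1 (j.1 + 1)) fun _ _ h =>
    LegFlag.ext hβ fun j hj => congrFun h ⟨j, hj⟩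

/-- The summand of a Harish-Chandra induced character, in terms of the determinants on the
members of the flag rather than on the successive quotients. -/
theorem prod_quotDet_eq {n l : ℕ} {β : ℕ → ℕ} (hβ : ∀ j, l < j → β j = 0)
    (γ : ℕ → (Fˣ →* ℂˣ)) (g : GL (Fin n) F) (V : LegFlag β g) :
    ∏ j ∈ Finset.range (l + 1), χap (γ j) (quotDet g.1.mulVecLin (V.1 j) (V.1 (j + 1))) =
      χap (γ 0) g.1.det * ∏ j : Fin l, χap (γ (j + 1) * (γ j)⁻¹)
        (LinearMap.det (g.1.mulVecLin.restrict (V.2.2.2.2 (j + 1)))) := by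
  have hne (j : ℕ) : LinearMap.det (g.1.mulVecLin.restrict (V.2.2.2.2 j)) ≠ 0 := by
    have hinj : Function.Injective (g.1.mulVecLin.restrict (V.2.2.2.2 j)) := fun x y hxy =>
      Subtype.ext (Matrix.mulVecLin_unit_injective g (congrArg Subtype.val hxy))
    exact (((LinearMap.isUnit_iff_ker_eq_bot _).2 (LinearMap.ker_eq_bot.2 hinj)).map
      LinearMap.det).ne_zero
  let D (j : ℕ) : Fˣ := Units.mk0 _ (hne j)
  have hD (j : ℕ) : LinearMap.det (g.1.mulVecLin.restrict (V.2.2.2.2 j)) = D j := rfl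
  have hquot (j : ℕ) : quotDet g.1.mulVecLin (V.1 j) (V.1 (j + 1)) = (D j / D (j + 1) : Fˣ) := by
    rw [Units.val_div_eq_div_val, eq_div_iff (D (j + 1)).ne_zero, mul_comm, ← hD, ← hD,
      ← det_restrict_eq_mul_quotDet _ (V.2.2.1 j)]
  have h0 : (D 0 : F) = g.1.det := by
    refine Matrix.det_restrict_range_eq (y := 1) ?_ (by rw [mul_one, one_mul]) ?_ _
    · rw [Matrix.mulVecLin_one]
      exact Function.injective_id
    · rw [Matrix.mulVecLin_one, LinearMap.range_id, V.2.1]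
  have hlast : D (l + 1) = 1 := Units.ext <| LinearMap.det_eq_one_of_finrank_eq_zero
    ((V.2.2.2.1 _).trans (hβ _ l.lt_succ_self)) _
  simp only [hquot, hD, ← h0, χap_coe]
  have h := congrArg (Units.val) (prod_range_apply_div γ D l)
  rw [hlast, map_one, inv_one, mul_one] at h
  simpa [Finset.prod_range] using h

end Flags

section Star

variable {k m n : ℕ} {s : Fin k → ℕ} {nn : Fin k → ℕ → ℕ}

theorem legPrev_elim {X : Type} {f : Fin k → ℕ → X} {c : X} (hf : ∀ i, f i 0 = c)
    (a : (i : Fin k) × Fin (s i)) :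
    (legPrev k s a).elim c (fun b => f b.1 (b.2.1 + 1)) = f a.1 a.2.1 := by
  obtain ⟨i, ⟨_ | j, hj⟩⟩ := a
  · exact (hf i).symm
  · rfl

/-- The distance of a vertex of the star-shaped quiver to the central vertex. -/
def starDepth (k : ℕ) (s : Fin k → ℕ) (v : StarV k s) : ℕ :=
  v.elim 0 fun a => a.2.1 + 1

theorem starDepth_legPrev_lt (a : (i : Fin k) × Fin (s i)) :
    starDepth k s (legPrev k s a) < starDepth k s (some a) :=
  (legPrev_elim (f := fun _ j => j) (fun _ => rfl) a).trans_lt a.2.1.lt_succ_self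

theorem legβ_eq_zero (i : Fin k) (j : ℕ) (hj : s i < j) : legβ k s nn i j = 0 := by
  rw [legβ, Finset.Icc_eq_empty (by omega), Finset.sum_empty]

variable {F : Type} [Field F]

theorem isStableFlag_of_legFlag {h : GL (Fin n) F} (V : ∀ i, LegFlag (legβ k s nn i) h) :
    IsStableFlag (legPrev k s) (starα k n s nn) h fun a => (V a.1).1 (a.2.1 + 1) := by
  refine fun a => ⟨?_, (V a.1).2.2.2.1 _, (V a.1).2.2.2.2 _⟩
  exact ((V a.1).2.2.1 a.2.1).trans
    (legPrev_elim (f := fun i => (V i).1) (fun i => (V i).2.1) a).ge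

theorem bijective_legFlag (hsum : ∀ i, legβ k s nn i 0 = n) (h : GL (Fin n) F) :
    Function.Bijective fun V : ∀ i, LegFlag (legβ k s nn i) h =>
      (⟨_, isStableFlag_of_legFlag V⟩ :
        {V // IsStableFlag (legPrev k s) (starα k n s nn) h V}) := by
  refine ⟨fun V W hVW => funext fun i => ?_, fun ⟨W, hW⟩ => ?_⟩
  · exact LegFlag.ext (legβ_eq_zero i) fun j hj =>
      congrFun (congrArg Subtype.val hVW) ⟨i, ⟨j, hj⟩⟩
  · let V : Fin k → ℕ → Submodule F (Fin n → F) := fun i j =>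
      match j with
      | 0 => ⊤
      | j + 1 => if hj : j < s i then W ⟨i, ⟨j, hj⟩⟩ else ⊥
    have hVpos (i : Fin k) (j : ℕ) (hj : j < s i) : V i (j + 1) = W ⟨i, ⟨j, hj⟩⟩ :=
      dif_pos hj
    have hVneg (i : Fin k) (j : ℕ) (hj : ¬ j < s i) : V i (j + 1) = ⊥ := dif_neg hj
    have hVW (a : (i : Fin k) × Fin (s i)) : V a.1 (a.2.1 + 1) = W a := hVpos _ _ a.2.2
    have hprev (a : (i : Fin k) × Fin (s i)) : (legPrev k s a).elim ⊤ W = V a.1 a.2.1 :=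
      (congrArg (fun U => (legPrev k s a).elim ⊤ U) (funext hVW)).symm.trans
        (legPrev_elim (f := V) (c := ⊤) (fun _ => rfl) a)
    refine ⟨fun i => ⟨V i, rfl, fun j => ?_, fun j => ?_, fun j => ?_⟩,
      Subtype.ext (funext hVW)⟩
    · by_cases hj : j < s i
      · rw [hVpos i j hj]
        exact (hW ⟨i, ⟨j, hj⟩⟩).1.trans (hprev _).le
      · rw [hVneg i j hj]
        exact bot_le
    · rcases j with _ | j
      · rw [hsum]
        exact finrank_top _ _ |>.trans (Module.finrank_fin_fun F)
      · by_cases hj : j < s i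
        · rw [hVpos i j hj]
          exact (hW ⟨i, ⟨j, hj⟩⟩).2.1
        · rw [hVneg i j hj, finrank_bot, legβ_eq_zero i _ (by omega)]
    · rcases j with _ | j
      · exact fun _ _ => trivial
      · by_cases hj : j < s i
        · rw [hVpos i j hj]
          exact (hW ⟨i, ⟨j, hj⟩⟩).2.2
        · rw [hVneg i j hj]
          rintro v hv
          rw [(Submodule.mem_bot F).1 hv, map_zero]
          exact zero_mem _

/-- A product of Harish-Chandra induced characters as a sum over families of flags along
the legs of the star. -/
theorem prod_HC_eq_finsum [Finite F] (hsum : ∀ i, legβ k s nn i 0 = n)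
    (γ : Fin k → ℕ → (Fˣ →* ℂˣ)) (h : GL (Fin n) F) :
    ∏ i, HC F n (s i) (legβ k s nn i) (γ i) h =
      ∑ᶠ V : {V // IsStableFlag (legPrev k s) (starα k n s nn) h V},
        (∏ i, χap (γ i 0) h.1.det) * ∏ a, χap (starσ F k s γ (some a)) (flagDet V a) := by
  classical
  have (i : Fin k) : Finite (LegFlag (legβ k s nn i) h) := LegFlag.finite (legβ_eq_zero i) h
  have (i : Fin k) : Fintype (LegFlag (legβ k s nn i) h) := Fintype.ofFinite _
  calc _ = ∏ i, ∑ V : LegFlag (legβ k s nn i) h, χap (γ i 0) h.1.det *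
        ∏ j : Fin (s i), χap (γ i (j + 1) * (γ i j)⁻¹)
          (LinearMap.det (h.1.mulVecLin.restrict (V.2.2.2.2 (j + 1)))) := by
        refine Finset.prod_congr rfl fun i _ => ?_
        rw [HC, finsum_eq_sum_of_fintype]
        exact Finset.sum_congr rfl fun V _ => prod_quotDet_eq (legβ_eq_zero i) (γ i) h V
    _ = _ := by
        rw [Fintype.prod_sum, ← finsum_eq_sum_of_fintype]
        refine finsum_eq_of_bijective _ (bijective_legFlag hsum h) fun V => ?_
        rw [Finset.prod_mul_distrib, Fintype.prod_sigma]
        rfl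

theorem glAct_eq_self_iff {I Ω : Type} {src tgt : Ω → I} {β : I → ℕ}
    (g : ∀ i, GL (Fin (β i)) F) (x : Rep src tgt F β) :
    glAct src tgt g x = x ↔ ∀ a, (g (tgt a)).1 * x a = x a * (g (src a)).1 := by
  refine funext_iff.trans (forall_congr' fun a => ?_)
  change (g (tgt a)).1 * x a * (g (src a))⁻¹.1 = x a ↔ _
  refine ⟨fun h => ?_, fun h => ?_⟩
  · rw [← Matrix.mul_one ((g (tgt a)).1 * x a), ← Units.inv_mul (g (src a)),
      ← Matrix.mul_assoc, h]
  · rw [h, Matrix.mul_assoc, Units.mul_inv, Matrix.mul_one]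

/-- A fixed representation of the star consists of matrices at the loops commuting with the
central component and of an intertwiner along the legs. -/
theorem card_fixed_injective_eq (g : ∀ v, GL (Fin (starα k n s nn v)) F) :
    Nat.card {x : Rep (starSrc k m s) (starTgt k m s) F (starα k n s nn) //
      glAct (starSrc k m s) (starTgt k m s) g x = x ∧
      ∀ a : (i : Fin k) × Fin (s i),
        Function.Injective (Matrix.mulVecLin (x (Sum.inr a)))} =
    Λcount F n m (g none) *
      Nat.card {x // IsIntertwiner (legPrev k s) (starα k n s nn) g x} := by
  have hΛ (h : GL (Fin n) F) : Λcount F n m h =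
      Nat.card {A : Fin m → Matrix (Fin n) (Fin n) F // ∀ r, h.1 * A r = A r * h.1} := rfl
  refine Eq.trans (Eq.trans (Nat.card_congr ?_) (Nat.card_prod _ _))
    (congrArg (· * _) (hΛ (g none)).symm)
  exact
    { toFun := fun x => ⟨⟨fun r => x.1 (.inl r), fun r =>
          (glAct_eq_self_iff g x.1).1 x.2.1 (.inl r)⟩,
        ⟨fun a => x.1 (.inr a), fun a =>
          ⟨(glAct_eq_self_iff g x.1).1 x.2.1 (.inr a), x.2.2 a⟩⟩⟩
      invFun := fun y => ⟨fun a => match a with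
          | .inl r => y.1.1 r
          | .inr a => y.2.1 a,
        (glAct_eq_self_iff g _).2 fun a => match a with
          | .inl r => y.1.2 r
          | .inr a => (y.2.2 a).1,
        fun a => (y.2.2 a).2⟩
      left_inv := fun x => Subtype.ext (funext fun a => by cases a <;> rfl)
      right_inv := fun y => rfl }

end Star

end QRep

open QRep in
/-- `⟨R*_α ⊗ ρ_σ, 1⟩ = ⟨Λ ⊗ R(γ_1) ⊗ ⋯ ⊗ R(γ_k), 1⟩`: the averaged sum
over `GL_α(𝔽_q)` of (number of representations with injective leg maps fixed by `g`)
times `ρ_σ(g) = ∏_v σ_v(det g_v)` equals the multiplicity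
`(1/|GL_n(𝔽_q)|) Σ_h Λ_m(h) ∏_i R(γ_i)(h)`. -/
theorem statement6 (F : Type) [Field F] [Fintype F] (k m n : ℕ) (hk : 1 ≤ k) (hn : 1 ≤ n)
    (s : Fin k → ℕ) (nn : Fin k → ℕ → ℕ) (hsum : ∀ i, legβ k s nn i 0 = n)
    (γ : Fin k → ℕ → (Fˣ →* ℂˣ)) :
    (Nat.card (∀ v, GL (Fin (starα k n s nn v)) F) : ℂ)⁻¹ *
      ∑ᶠ g : ∀ v, GL (Fin (starα k n s nn v)) F,
        (Nat.card {x : Rep (starSrc k m s) (starTgt k m s) F (starα k n s nn) //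
            glAct (starSrc k m s) (starTgt k m s) g x = x ∧
            ∀ a : (i : Fin k) × Fin (s i),
              Function.Injective (Matrix.mulVecLin (x (Sum.inr a)))} : ℂ) *
          ∏ v, ((starσ F k s γ v (Matrix.GeneralLinearGroup.det (g v)) : ℂˣ) : ℂ) =
    mult F k m n s nn γ := by
  let W (h : GL (Fin n) F) (D : ((i : Fin k) × Fin (s i)) → F) : ℂ :=
    Λcount F n m h * ((∏ i, χap (γ i 0) h.1.det) * ∏ a, χap (starσ F k s γ (some a)) (D a))
  have hterm (g : ∀ v, GL (Fin (starα k n s nn v)) F) :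
      (Nat.card {x : Rep (starSrc k m s) (starTgt k m s) F (starα k n s nn) //
          glAct (starSrc k m s) (starTgt k m s) g x = x ∧
          ∀ a : (i : Fin k) × Fin (s i),
            Function.Injective (Matrix.mulVecLin (x (Sum.inr a)))} : ℂ) *
        ∏ v, ((starσ F k s γ v (Matrix.GeneralLinearGroup.det (g v)) : ℂˣ) : ℂ) =
      (Nat.card {x // IsIntertwiner (legPrev k s) (starα k n s nn) g x} : ℂ) *
        W (g none) fun a => (g (some a)).1.det := by
    have hχ {d : ℕ} (χ : Fˣ →* ℂˣ) (u : GL (Fin d) F) :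
        χap χ u.1.det = χ (Matrix.GeneralLinearGroup.det u) := 
      χap_coe χ (Matrix.GeneralLinearGroup.det u)
    have h0 : ((starσ F k s γ none (Matrix.GeneralLinearGroup.det (g none)) : ℂˣ) : ℂ) =
        ∏ i, χap (γ i 0) (g none).1.det := by
      simp only [starσ, MonoidHom.finsetProd_apply, Units.coe_prod]
      exact Finset.prod_congr rfl fun i _ => (hχ _ _).symm
    rw [card_fixed_injective_eq, Fintype.prod_option, h0, Nat.cast_mul, mul_assoc,
      mul_left_comm]
    simp only [← hχ]
    rfl
  have hsumW (h : GL (Fin n) F) :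
      ∑ᶠ V : {V // IsStableFlag (legPrev k s) (starα k n s nn) h V},
        W h (flagDet V) =
      (Λcount F n m h : ℂ) * ∏ i : Fin k, HC F n (s i) (legβ k s nn i) (γ i) h := by
    rw [prod_HC_eq_finsum hsum, mul_finsum]
  have hcard : Nat.card (∀ v, GL (Fin (starα k n s nn v)) F) =
      Nat.card (GL (Fin n) F) * Nat.card (∀ a, GL (Fin (starα k n s nn (some a))) F) := by
    rw [Nat.card_congr Equiv.piOptionEquivProd, Nat.card_prod]
    rfl
  have hne : (Nat.card (∀ a, GL (Fin (starα k n s nn (some a))) F) : ℂ) ≠ 0 :=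
    Nat.cast_ne_zero.2 Nat.card_pos.ne'
  rw [finsum_congr hterm,
    finsum_card_isIntertwiner (starDepth k s) starDepth_legPrev_lt (α := starα k n s nn) W,
    mult, hcard, Nat.cast_mul, mul_inv, mul_assoc, inv_mul_cancel_left₀ hne]
  exact congrArg _ (finsum_congr hsumW)
end
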